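/- Let S_1, …, S_r be pairwise commuting Hermitian complex 2^N × 2^N matrices with S_j^2 = 1, Π = ∏_{j=1}^r (1 + S_j)/2, and ψ_0 ∈ ℂ^{2^N} a unit vector with S_j ψ_0 = ψ_0 for all j; set ρ_0 = ψ_0 ψ_0ᴴ. Fix d ≥ 1 and assume that for every pair (x,z) with 1 ≤ w(x,z) < d there exists j with S_j σ_{(x,z)} = − σ_{(x,z)} S_j. Let ℰ = ℰ_N ∘ ⋯ ∘ ℰ_1 be the composition of the single-site depolarizing maps ℰ_i(ρ) = (1−p)ρ + (p/3)(X_i ρ X_i + Y_i ρ Y_i + Z_i ρ Z_i) with 0 ≤ p ≤ 1. Then for every 2^N × 2^N matrix O, Tr(Π ℰ(ρ_0) Π O) = (1−p)^N · ψ_0ᴴ O ψ_0 + Σ_{P : w(P) ≥ d} (1−p)^{N−w(P)} (p/3)^{w(P)} Tr(Π P̃ ρ_0 P̃ᴴ Π O), where the sum is over assignments P ∈ {1,X,Y,Z}^N with weight at least d; in particular the error in the projected expectation value is of order p^d. -/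

import Mathlib

open Matrix BigOperators

/-- The single-qubit Pauli `X` matrix. -/
noncomputable def pX : Matrix (Fin 2) (Fin 2) ℂ := !![0, 1; 1, 0]

/-- The single-qubit Pauli `Y` matrix. -/
noncomputable def pY : Matrix (Fin 2) (Fin 2) ℂ := !![0, -Complex.I; Complex.I, 0]

/-- The single-qubit Pauli `Z` matrix. -/
noncomputable def pZ : Matrix (Fin 2) (Fin 2) ℂ := !![1, 0; 0, -1]

/-- The `N`-fold Kronecker (tensor) product of a family of single-qubit matrices,
realized on the tensor product space indexed by `Fin N → Fin 2`. -/
noncomputable def kron {N : ℕ} (M : Fin N → Matrix (Fin 2) (Fin 2) ℂ) :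
    Matrix (Fin N → Fin 2) (Fin N → Fin 2) ℂ :=
  Matrix.of fun a b => ∏ i, M i (a i) (b i)

/-- The Pauli string `σ_{(x,z)} = ⊗ᵢ X^{xᵢ} Z^{zᵢ}`. -/
noncomputable def pauliString {N : ℕ} (x z : Fin N → Bool) :
    Matrix (Fin N → Fin 2) (Fin N → Fin 2) ℂ :=
  kron fun i => pX ^ (x i).toNat * pZ ^ (z i).toNat

/-- The weight `w(x,z)` of a Pauli string: the number of sites with `(xᵢ,zᵢ) ≠ (0,0)`. -/
def pauliStringWeight {N : ℕ} (x z : Fin N → Bool) : ℕ :=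
  (Finset.univ.filter fun i => ¬(x i = false ∧ z i = false)).card

/-- `A_i = 1^{⊗(i−1)} ⊗ A ⊗ 1^{⊗(N−i)}`: the single-qubit matrix `A` acting on site `i`. -/
noncomputable def siteOp {N : ℕ} (i : Fin N) (A : Matrix (Fin 2) (Fin 2) ℂ) :
    Matrix (Fin N → Fin 2) (Fin N → Fin 2) ℂ :=
  kron fun j => if j = i then A else 1

/-- The single-site depolarizing channel with rate `p` acting on site `i`:
`ℰᵢ(ρ) = (1−p)ρ + (p/3)(Xᵢ ρ Xᵢ + Yᵢ ρ Yᵢ + Zᵢ ρ Zᵢ)`. -/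
noncomputable def depol {N : ℕ} (p : ℝ) (i : Fin N)
    (ρ : Matrix (Fin N → Fin 2) (Fin N → Fin 2) ℂ) :
    Matrix (Fin N → Fin 2) (Fin N → Fin 2) ℂ :=
  ((1 - p : ℝ) : ℂ) • ρ +
    ((p / 3 : ℝ) : ℂ) •
      (siteOp i pX * ρ * siteOp i pX + siteOp i pY * ρ * siteOp i pY +
        siteOp i pZ * ρ * siteOp i pZ)

/-- The assignment `{1, X, Y, Z}` of a single-qubit Pauli (or identity) to a label. -/
noncomputable def pauliOfLabel : Fin 4 → Matrix (Fin 2) (Fin 2) ℂ := ![1, pX, pY, pZ]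

/-- The weight of an assignment `P ∈ {1,X,Y,Z}^N`: the number of non-identity sites. -/
def pauliWeight {N : ℕ} (P : Fin N → Fin 4) : ℕ :=
  (Finset.univ.filter fun i => P i ≠ 0).card

lemma kron_mul {N : ℕ} (A B : Fin N → Matrix (Fin 2) (Fin 2) ℂ) :
    kron A * kron B = kron fun i => A i * B i := by
  ext a b
  simp only [kron, Matrix.mul_apply, Matrix.of_apply, ← Finset.prod_mul_distrib]
  rw [Finset.prod_univ_sum, Fintype.piFinset_univ]

lemma kron_one {N : ℕ} : kron (fun _ : Fin N => 1) = 1 := by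
  ext a b
  simp only [kron, Matrix.of_apply, Matrix.one_apply, Finset.prod_ite_zero, funext_iff]
  simp

lemma kron_smul {N : ℕ} (c : Fin N → ℂ) (A : Fin N → Matrix (Fin 2) (Fin 2) ℂ) :
    kron (fun i => c i • A i) = (∏ i, c i) • kron A := by
  ext a b
  simp [kron, Finset.prod_mul_distrib]

lemma conjTranspose_kron {N : ℕ} (A : Fin N → Matrix (Fin 2) (Fin 2) ℂ) :
    (kron A)ᴴ = kron fun i => (A i)ᴴ := by
  ext a b
  simp [kron]

lemma prod_map_siteOp {N : ℕ} (M : Fin N → Matrix (Fin 2) (Fin 2) ℂ) {l : List (Fin N)}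
    (hl : l.Nodup) :
    (l.map fun i => siteOp i (M i)).prod = kron fun i => if i ∈ l then M i else 1 := by
  induction l with
  | nil => simp [kron_one]
  | cons k l ih =>
    rw [List.nodup_cons] at hl
    rw [List.map_cons, List.prod_cons, ih hl.2, siteOp, kron_mul]
    congr 1
    funext i
    by_cases h : i = k
    · subst h; simp [hl.1]
    · simp [h]

lemma prod_reverse_ofFn_siteOp {N : ℕ} (M : Fin N → Matrix (Fin 2) (Fin 2) ℂ) :
    (List.ofFn fun i => siteOp i (M i)).reverse.prod = kron M := by
  rw [List.ofFn_eq_map, ← List.map_reverse,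
    prod_map_siteOp M (List.nodup_reverse.2 (List.nodup_finRange N))]
  simp

/-- A composition of maps in Kraus form is again in Kraus form, with Kraus operators the products
of the individual ones. -/
lemma foldl_ofFn_kraus {n α : Type*} [Fintype n] [DecidableEq n] [Fintype α] (c : α → ℂ) {m : ℕ}
    (K : Fin m → α → Matrix n n ℂ) (f : Fin m → Matrix n n ℂ → Matrix n n ℂ)
    (hf : ∀ j ρ, f j ρ = ∑ a, c a • (K j a * ρ * (K j a)ᴴ)) (ρ : Matrix n n ℂ) :
    (List.ofFn f).foldl (fun σ g => g σ) ρ =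
      ∑ P : Fin m → α, (∏ j, c (P j)) •
        ((List.ofFn fun j => K j (P j)).reverse.prod * ρ *
          (List.ofFn fun j => K j (P j)).reverse.prodᴴ) := by
  induction m generalizing ρ with
  | zero => simp
  | succ m ih =>
    rw [List.ofFn_succ, List.foldl_cons,
      ih (fun j => K j.succ) (fun j => f j.succ) (fun j => hf j.succ), hf,
      ← (Fin.consEquiv fun _ => α).sum_comp, Fintype.sum_prod_type, Finset.sum_comm]
    refine Finset.sum_congr rfl fun P _ => ?_
    simp only [Fin.consEquiv_apply, Fin.prod_univ_succ, Fin.cons_zero, Fin.cons_succ,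
      List.ofFn_succ, List.reverse_cons, List.prod_append, List.prod_singleton,
      Matrix.mul_sum, Matrix.sum_mul, Finset.smul_sum, Matrix.conjTranspose_mul]
    refine Finset.sum_congr rfl fun a _ => ?_
    simp only [Matrix.mul_smul, Matrix.smul_mul, smul_smul, Matrix.mul_assoc, mul_comm]

lemma conjTranspose_pauliOfLabel (a : Fin 4) : (pauliOfLabel a)ᴴ = pauliOfLabel a := by
  fin_cases a <;> ext i j <;> fin_cases i <;> fin_cases j <;> simp [pauliOfLabel, pX, pY, pZ]

lemma conjTranspose_siteOp {N : ℕ} (i : Fin N) (A : Matrix (Fin 2) (Fin 2) ℂ) :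
    (siteOp i A)ᴴ = siteOp i Aᴴ := by
  rw [siteOp, conjTranspose_kron, siteOp]
  congr 1
  funext j
  split_ifs <;> simp

lemma siteOp_one {N : ℕ} (i : Fin N) : siteOp i 1 = 1 := by
  simp [siteOp, kron_one]

lemma depol_eq_sum {N : ℕ} (p : ℝ) (i : Fin N) (ρ : Matrix (Fin N → Fin 2) (Fin N → Fin 2) ℂ) :
    depol p i ρ = ∑ a : Fin 4, (if a ≠ 0 then ((p / 3 : ℝ) : ℂ) else ((1 - p : ℝ) : ℂ)) •
      (siteOp i (pauliOfLabel a) * ρ * (siteOp i (pauliOfLabel a))ᴴ) := by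
  simp only [conjTranspose_siteOp, conjTranspose_pauliOfLabel]
  simp [Fin.sum_univ_four, pauliOfLabel, siteOp_one, depol, add_assoc]

lemma prod_label_weights {N : ℕ} (x y : ℂ) (P : Fin N → Fin 4) :
    ∏ j, (if P j ≠ 0 then y else x) = x ^ (N - pauliWeight P) * y ^ pauliWeight P := by
  have h := Finset.card_filter_add_card_filter_not (s := (Finset.univ : Finset (Fin N)))
    (fun i => P i ≠ 0)
  rw [Finset.card_univ, Fintype.card_fin] at h
  rw [Finset.prod_ite, Finset.prod_const, Finset.prod_const, mul_comm, pauliWeight]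
  congr 2
  omega

/-- The composite depolarizing channel as a sum over all Pauli errors. -/
lemma foldl_depol {N : ℕ} (p : ℝ) (ρ : Matrix (Fin N → Fin 2) (Fin N → Fin 2) ℂ) :
    (List.ofFn fun i : Fin N => depol p i).foldl (fun σ f => f σ) ρ =
      ∑ P : Fin N → Fin 4,
        (((1 - p) ^ (N - pauliWeight P) * (p / 3) ^ pauliWeight P : ℝ) : ℂ) •
          ((kron fun j => pauliOfLabel (P j)) * ρ * (kron fun j => pauliOfLabel (P j))ᴴ) := by
  rw [foldl_ofFn_kraus _ (fun i a => siteOp i (pauliOfLabel a)) _ (depol_eq_sum p)]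
  simp only [prod_label_weights, prod_reverse_ofFn_siteOp]
  push_cast
  rfl

/-- Every assignment of Pauli labels is a scalar multiple of a Pauli string of the same weight. -/
lemma exists_kron_eq_smul_pauliString {N : ℕ} (P : Fin N → Fin 4) :
    ∃ (c : ℂ) (x z : Fin N → Bool), pauliStringWeight x z = pauliWeight P ∧
      (kron fun j => pauliOfLabel (P j)) = c • pauliString x z := by
  have h (a : Fin 4) : ∃ (c : ℂ) (x z : Bool), (¬(x = false ∧ z = false) ↔ a ≠ 0) ∧
      pauliOfLabel a = c • (pX ^ x.toNat * pZ ^ z.toNat) := by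
    fin_cases a
    · exact ⟨1, false, false, by simp, by simp [pauliOfLabel]⟩
    · exact ⟨1, true, false, by simp, by simp [pauliOfLabel]⟩
    · exact ⟨Complex.I, true, true, by simp, by simp [pauliOfLabel, pX, pY, pZ]⟩
    · exact ⟨1, false, true, by simp, by simp [pauliOfLabel]⟩
  choose c x z hw hP using h
  refine ⟨∏ j, c (P j), fun j => x (P j), fun j => z (P j), ?_, ?_⟩
  · simp only [pauliStringWeight, pauliWeight, hw]
  · simp only [hP, kron_smul, pauliString]

lemma pauliWeight_eq_zero_iff {N : ℕ} (P : Fin N → Fin 4) : pauliWeight P = 0 ↔ P = 0 := by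
  simp [pauliWeight, Finset.filter_eq_empty_iff, funext_iff]

section Projector

variable {n : Type*} [Fintype n] [DecidableEq n] {r : ℕ} {S : Fin r → Matrix n n ℂ}

/-- The codespace projector `Π` of a family of stabilizer generators. -/
noncomputable def codeProjector (S : Fin r → Matrix n n ℂ) : Matrix n n ℂ :=
  (List.ofFn fun j : Fin r => ((1 / 2 : ℂ) • (1 + S j))).prod

lemma codeProjector_mul_generator (hsq : ∀ j, S j * S j = 1)
    (hcomm : ∀ i j, S i * S j = S j * S i) (j : Fin r) :
    codeProjector S * S j = codeProjector S := by
  have hc : ∀ l : List (Fin r),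
      Commute (l.map fun j => ((1 / 2 : ℂ) • (1 + S j))).prod (S j) := fun l =>
    Commute.list_prod_left _ _ fun A hA => by
      obtain ⟨i, -, rfl⟩ := List.mem_map.1 hA
      exact ((Commute.one_left _).add_left (hcomm i j)).smul_left _
  obtain ⟨s, t, hst⟩ := List.append_of_mem (List.mem_finRange j)
  have hj : ((1 / 2 : ℂ) • (1 + S j)) * S j = (1 / 2 : ℂ) • (1 + S j) := by
    rw [Matrix.smul_mul, add_mul, one_mul, hsq, add_comm]
  rw [codeProjector, List.ofFn_eq_map, hst, List.map_append, List.map_cons, List.prod_append,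
    List.prod_cons, mul_assoc, mul_assoc, (hc t).eq, ← mul_assoc _ (S j), hj]

lemma codeProjector_mulVec {ψ : n → ℂ} (hψ : ∀ j, S j *ᵥ ψ = ψ) : codeProjector S *ᵥ ψ = ψ := by
  have h : ∀ l : List (Fin r),
      (l.map fun j => ((1 / 2 : ℂ) • (1 + S j))).prod *ᵥ ψ = ψ := fun l => by
    induction l with
    | nil => simp
    | cons j l ih =>
      rw [List.map_cons, List.prod_cons, ← Matrix.mulVec_mulVec, ih, Matrix.smul_mulVec,
        Matrix.add_mulVec, Matrix.one_mulVec, hψ, ← two_smul ℂ ψ, smul_smul]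
      norm_num
  rw [codeProjector, List.ofFn_eq_map, h]

lemma vecMul_codeProjector {ψ : n → ℂ} (hψ : ∀ j, ψ ᵥ* S j = ψ) : ψ ᵥ* codeProjector S = ψ := by
  have h : ∀ l : List (Fin r),
      ψ ᵥ* (l.map fun j => ((1 / 2 : ℂ) • (1 + S j))).prod = ψ := fun l => by
    induction l with
    | nil => simp
    | cons j l ih =>
      rw [List.map_cons, List.prod_cons, ← Matrix.vecMul_vecMul, Matrix.vecMul_smul,
        Matrix.vecMul_add, Matrix.vecMul_one, hψ, ← two_smul ℂ ψ, smul_smul]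
      rw [one_div_mul_cancel two_ne_zero, one_smul, ih]
  rw [codeProjector, List.ofFn_eq_map, h]

lemma codeProjector_mulVec_eq_zero_of_anticommute (hsq : ∀ j, S j * S j = 1)
    (hcomm : ∀ i j, S i * S j = S j * S i) {ψ : n → ℂ} (hψ : ∀ j, S j *ᵥ ψ = ψ)
    {E : Matrix n n ℂ} {j : Fin r} (hE : S j * E = -(E * S j)) :
    codeProjector S *ᵥ (E *ᵥ ψ) = 0 := by
  have h : codeProjector S *ᵥ (E *ᵥ ψ) = -(codeProjector S *ᵥ (E *ᵥ ψ)) := by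
    conv_lhs => rw [← codeProjector_mul_generator hsq hcomm j, ← Matrix.mulVec_mulVec,
      Matrix.mulVec_mulVec _ (S j), hE, Matrix.neg_mulVec, ← Matrix.mulVec_mulVec, hψ,
      Matrix.mulVec_neg]
  exact self_eq_neg.1 h

end Projector

/-- error-mitigation capability of code-space projection.  For a codeword
state `ρ₀ = ψ₀ψ₀ᴴ` of a code detecting all Pauli errors of weight `< d`, and the
composite single-site depolarizing channel `ℰ = ℰ_N ∘ ⋯ ∘ ℰ_1`, the projected expectation
value satisfies
`Tr(Π ℰ(ρ₀) Π O) = (1−p)^N ψ₀ᴴOψ₀ + ∑_{w(P) ≥ d} (1−p)^{N−w(P)} (p/3)^{w(P)} Tr(Π P̃ρ₀P̃ᴴ Π O)`,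
so the error in the projected expectation value is of order `p^d`. -/
theorem projected_depolarized_expectation
    (N r : ℕ) (hN : 1 ≤ N) (S : Fin r → Matrix (Fin N → Fin 2) (Fin N → Fin 2) ℂ)
    (hherm : ∀ j, (S j)ᴴ = S j)
    (hsq : ∀ j, S j * S j = 1)
    (hcomm : ∀ i j, S i * S j = S j * S i)
    (ψ₀ : (Fin N → Fin 2) → ℂ)
    (hψ₀ : ∀ j, S j *ᵥ ψ₀ = ψ₀)
    (hunit : star ψ₀ ⬝ᵥ ψ₀ = 1)
    (d : ℕ) (hd : 1 ≤ d)
    (hdetect : ∀ x z : Fin N → Bool,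
      1 ≤ pauliStringWeight x z → pauliStringWeight x z < d →
      ∃ j, S j * pauliString x z = -(pauliString x z * S j))
    (p : ℝ) (hp0 : 0 ≤ p) (hp1 : p ≤ 1)
    (O : Matrix (Fin N → Fin 2) (Fin N → Fin 2) ℂ) :
    ((List.ofFn fun j : Fin r => ((1 / 2 : ℂ) • (1 + S j))).prod *
        ((List.ofFn fun i : Fin N => depol p i).foldl (fun σ f => f σ)
          (vecMulVec ψ₀ (star ψ₀))) *
        (List.ofFn fun j : Fin r => ((1 / 2 : ℂ) • (1 + S j))).prod * O).trace =
      (((1 - p) ^ N : ℝ) : ℂ) * (star ψ₀ ⬝ᵥ (O *ᵥ ψ₀)) +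
        ∑ P ∈ Finset.univ.filter (fun P : Fin N → Fin 4 => d ≤ pauliWeight P),
          (((1 - p) ^ (N - pauliWeight P) * (p / 3) ^ pauliWeight P : ℝ) : ℂ) *
            ((List.ofFn fun j : Fin r => ((1 / 2 : ℂ) • (1 + S j))).prod *
              (kron fun j => pauliOfLabel (P j)) * vecMulVec ψ₀ (star ψ₀) *
              (kron fun j => pauliOfLabel (P j))ᴴ *
              (List.ofFn fun j : Fin r => ((1 / 2 : ℂ) • (1 + S j))).prod * O).trace := by
  rw [show (List.ofFn fun j : Fin r => ((1 / 2 : ℂ) • (1 + S j))).prod = codeProjector S from rfl]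
  have hleft : ∀ j, star ψ₀ ᵥ* S j = star ψ₀ := fun j => by
    conv_lhs => rw [← hherm j, ← Matrix.star_mulVec, hψ₀]
  rw [foldl_depol, Matrix.mul_sum, Matrix.sum_mul, Matrix.sum_mul, Matrix.trace_sum,
    ← Finset.sum_filter_add_sum_filter_not Finset.univ
      (fun P : Fin N → Fin 4 => d ≤ pauliWeight P), add_comm]
  congr 1
  · rw [Finset.sum_eq_single 0]
    · have h0 : pauliWeight (0 : Fin N → Fin 4) = 0 := (pauliWeight_eq_zero_iff _).2 rfl
      have h1 : (kron fun j => pauliOfLabel ((0 : Fin N → Fin 4) j)) = 1 := kron_one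
      rw [h0, h1, Matrix.conjTranspose_one, one_mul, mul_one, Matrix.mul_smul, Matrix.smul_mul,
        Matrix.smul_mul, Matrix.trace_smul, Matrix.mul_vecMulVec, codeProjector_mulVec hψ₀,
        Matrix.vecMulVec_mul, vecMul_codeProjector hleft, Matrix.vecMulVec_mul,
        Matrix.trace_vecMulVec, Matrix.dotProduct_mulVec, dotProduct_comm]
      simp
    · intro P hP hP0
      rw [Finset.mem_filter, not_le] at hP
      obtain ⟨c, x, z, hw, hc⟩ := exists_kron_eq_smul_pauliString P
      have hpos : pauliWeight P ≠ 0 := mt (pauliWeight_eq_zero_iff P).1 hP0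
      obtain ⟨j, hj⟩ := hdetect x z (by omega) (by omega)
      have hz := codeProjector_mulVec_eq_zero_of_anticommute hsq hcomm hψ₀
        (E := kron fun j => pauliOfLabel (P j)) (j := j)
        (by rw [hc, Matrix.mul_smul, hj, Matrix.smul_mul, smul_neg])
      rw [Matrix.mul_smul, Matrix.mul_vecMulVec, Matrix.vecMulVec_mul, Matrix.mul_vecMulVec, hz]
      simp
    · intro h
      refine absurd (Finset.mem_filter.2 ⟨Finset.mem_univ _, ?_⟩) h
      rw [(pauliWeight_eq_zero_iff _).2 rfl]
      omega
  · refine Finset.sum_congr rfl fun P _ => ?_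
    simp only [Matrix.mul_smul, Matrix.smul_mul, Matrix.trace_smul, smul_eq_mul, Matrix.mul_assoc]
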